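/- Let f = h + conj(g) be a sense-preserving univalent harmonic self-mapping of the unit disk 𝔻, and suppose that for some r with 0 < r < 1 one has m(f(𝔻_r)) = π r², where 𝔻_r = {z ∈ ℂ : |z| < r}. Then f is a conformal automorphism of 𝔻: g is constant on 𝔻 and there exist θ ∈ ℝ and a ∈ 𝔻 such that f(z) = e^{iθ}·(z − a)/(1 − conj(a)·z) for all z ∈ 𝔻. -/

import Mathlib

open MeasureTheory Metric Complex

open scoped Pointwise in
/-- One-dimensional Brunn–Minkowski inequality. -/
theorem volume_add_volume_le_volume_add {A B : Set ℝ} (hA : MeasurableSet A) (hB : MeasurableSet B)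
    (hA' : A.Nonempty) (hB' : B.Nonempty) : volume A + volume B ≤ volume (A + B) := by
  rw [hA.measure_eq_iSup_isCompact, hB.measure_eq_iSup_isCompact]
  simp only [iSup_and']
  refine ENNReal.biSup_add_biSup_le' ⟨∅, Set.empty_subset _, isCompact_empty⟩
    ⟨∅, Set.empty_subset _, isCompact_empty⟩ ?_
  rintro K ⟨hKA, hK⟩ L ⟨hLB, hL⟩
  rcases K.eq_empty_or_nonempty with rfl | hKn
  · obtain ⟨a, ha⟩ := hA'
    simpa using (measure_preimage_add volume (-a) L).symm.le.trans
      (measure_mono fun x hx => Set.mem_add.2 ⟨a, ha, -a + x, hLB hx, by simp⟩)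
  rcases L.eq_empty_or_nonempty with rfl | hLn
  · obtain ⟨b, hb⟩ := hB'
    simpa using (measure_preimage_add_right volume (-b) K).symm.le.trans
      (measure_mono fun x hx => Set.mem_add.2 ⟨x + -b, hKA hx, b, hb, by simp⟩)
  obtain ⟨k, hk, hkmax⟩ := hK.exists_isGreatest hKn
  obtain ⟨l, hl, hlmin⟩ := hL.exists_isLeast hLn
  have h1 : volume ((fun x => -l + x) ⁻¹' K) = volume K := measure_preimage_add volume (-l) K
  have h2 : volume ((fun x => -k + x) ⁻¹' L) = volume L := measure_preimage_add volume (-k) L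
  rw [← h1, ← h2, ← measure_union₀]
  · refine measure_mono ?_
    rintro x (hx | hx)
    · exact ⟨-l + x, hKA hx, l, hLB hl, by simp⟩
    · exact ⟨k, hKA hk, -k + x, hLB hx, by simp⟩
  · exact (hL.measurableSet.preimage (by fun_prop)).nullMeasurableSet
  · refine measure_mono_null (t := {k + l}) ?_ (by simp)
    rintro x ⟨hx1, hx2⟩
    have a1 := hkmax hx1
    have a2 := hlmin hx2
    simp only [Set.mem_singleton_iff]
    linarith

/-- Scaled layer-cake formula. -/
theorem lintegral_ofReal_eq_mul_lintegral_meas {F : ℝ → ℝ} (hF : Measurable F)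
    (hF0 : ∀ x, 0 ≤ F x) {a : ℝ} (ha : 0 < a) :
    ∫⁻ x, ENNReal.ofReal (F x) =
      ENNReal.ofReal a * ∫⁻ t in Set.Ioi (0 : ℝ), volume {x | t * a < F x} := by
  have h1 : ∫⁻ x, ENNReal.ofReal (F x) =
      ENNReal.ofReal a * ∫⁻ x, ENNReal.ofReal (F x / a) := by
    rw [← lintegral_const_mul _ (by fun_prop)]
    refine lintegral_congr fun x => ?_
    rw [← ENNReal.ofReal_mul ha.le, mul_div_cancel₀ _ ha.ne']
  rw [h1, lintegral_eq_lintegral_meas_lt volume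
    (Filter.Eventually.of_forall fun x => div_nonneg (hF0 x) ha.le) (by fun_prop)]
  simp only [lt_div_iff₀ ha]

theorem mul_lintegral_meas_le_lintegral {F : ℝ → ℝ} (hF : Measurable F) (hF0 : ∀ x, 0 ≤ F x)
    {a : ℝ} (ha : 0 < a) :
    ENNReal.ofReal a * ∫⁻ t in Set.Ioo (0 : ℝ) 1, volume {x | t * a < F x} ≤
      ∫⁻ x, ENNReal.ofReal (F x) := by
  rw [lintegral_ofReal_eq_mul_lintegral_meas hF hF0 ha]
  gcongr
  exact fun t ht => ht.1

theorem lintegral_le_mul_lintegral_meas {F : ℝ → ℝ} (hF : Measurable F) (hF0 : ∀ x, 0 ≤ F x)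
    {a : ℝ} (ha : 0 < a) (hFa : ∀ x, F x ≤ a) :
    ∫⁻ x, ENNReal.ofReal (F x) ≤
      ENNReal.ofReal a * ∫⁻ t in Set.Ioo (0 : ℝ) 1, volume {x | t * a < F x} := by
  rw [lintegral_ofReal_eq_mul_lintegral_meas hF hF0 ha]
  refine mul_le_mul_right ?_ _
  rw [← lintegral_indicator measurableSet_Ioi, ← lintegral_indicator measurableSet_Ioo]
  refine lintegral_mono fun t => ?_
  by_cases ht : t ∈ Set.Ioo (0 : ℝ) 1
  · rw [Set.indicator_of_mem ht, Set.indicator_of_mem (show t ∈ Set.Ioi 0 from ht.1)]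
  · by_cases ht0 : 0 < t
    · have : {x | t * a < F x} = ∅ := by
        ext x
        have ht1 : 1 ≤ t := by
          by_contra! hlt
          exact ht ⟨ht0, hlt⟩
        have := hFa x
        simp only [Set.mem_ofPred_eq, Set.mem_empty_iff_false, iff_false, not_lt]
        nlinarith
      simp [this, Set.indicator_apply]
    · simp [ht0]

theorem exists_forall_volume_slice_le {A : Set (ℝ × ℝ)} (hA : IsCompact A) :
    ∃ C : ENNReal, C ≠ ⊤ ∧ ∀ x, volume (Prod.mk x ⁻¹' A) ≤ C :=
  ⟨volume (Prod.snd '' A), (hA.image continuous_snd).measure_ne_top,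
    fun x => measure_mono fun y hy => ⟨(x, y), hy, rfl⟩⟩

theorem lintegral_ofReal_volume_slice {A : Set (ℝ × ℝ)} (hA : IsCompact A) :
    ∫⁻ x, ENNReal.ofReal (volume (Prod.mk x ⁻¹' A)).toReal = volume A := by
  obtain ⟨C, hC, hle⟩ := exists_forall_volume_slice_le hA
  rw [Measure.volume_eq_prod, Measure.prod_apply hA.measurableSet]
  exact lintegral_congr fun x => ENNReal.ofReal_toReal (ne_top_of_le_ne_top hC (hle x))

theorem measurable_toReal_volume_slice {A : Set (ℝ × ℝ)} (hA : IsCompact A) :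
    Measurable fun x => (volume (Prod.mk x ⁻¹' A)).toReal :=
  (measurable_measure_prodMk_left hA.measurableSet).ennreal_toReal

theorem exists_bound_volume_slice {A : Set (ℝ × ℝ)} (hA : IsCompact A) (h0 : volume A ≠ 0) :
    ∃ a : ℝ, 0 < a ∧ (∀ x, (volume (Prod.mk x ⁻¹' A)).toReal ≤ a) ∧
      ∀ b < a, ∃ x, b < (volume (Prod.mk x ⁻¹' A)).toReal := by
  obtain ⟨C, hC, hle⟩ := exists_forall_volume_slice_le hA
  have hbdd : BddAbove (Set.range fun x => (volume (Prod.mk x ⁻¹' A)).toReal) :=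
    ⟨C.toReal, by rintro _ ⟨x, rfl⟩; exact ENNReal.toReal_mono hC (hle x)⟩
  refine ⟨⨆ x, (volume (Prod.mk x ⁻¹' A)).toReal, ?_, fun x => le_ciSup hbdd x,
    fun b hb => exists_lt_of_lt_ciSup hb⟩
  by_contra! hneg
  refine h0 ?_
  rw [← lintegral_ofReal_volume_slice hA]
  refine lintegral_eq_zero_of_ae_eq_zero (Filter.Eventually.of_forall fun x => ?_)
  simpa using (le_ciSup hbdd x).trans hneg

open scoped Pointwise in
/-- A planar Brunn–Minkowski inequality for sets of equal area. -/
theorem four_mul_volume_le_volume_add {A B : Set (ℝ × ℝ)} (hA : IsCompact A) (hB : IsCompact B)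
    (hAB : volume A = volume B) : 4 * volume A ≤ volume (A + B) := by
  rcases eq_or_ne (volume A) 0 with h0 | h0
  · simp [h0]
  obtain ⟨a, ha, hFa, hFa'⟩ := exists_bound_volume_slice hA h0
  obtain ⟨b, hb, hGb, hGb'⟩ := exists_bound_volume_slice hB (hAB ▸ h0)
  have hC : IsCompact (A + B) := hA.add hB
  have mF := measurable_toReal_volume_slice hA
  have mG := measurable_toReal_volume_slice hB
  have mH := measurable_toReal_volume_slice hC
  have iF := lintegral_le_mul_lintegral_meas mF (fun _ => ENNReal.toReal_nonneg) ha hFa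
  have iG := lintegral_le_mul_lintegral_meas mG (fun _ => ENNReal.toReal_nonneg) hb hGb
  have iH := mul_lintegral_meas_le_lintegral mH (fun _ => ENNReal.toReal_nonneg) (add_pos ha hb)
  rw [lintegral_ofReal_volume_slice hA] at iF
  rw [lintegral_ofReal_volume_slice hB] at iG
  rw [lintegral_ofReal_volume_slice hC] at iH
  obtain ⟨cA, hcA, hleA⟩ := exists_forall_volume_slice_le hA
  obtain ⟨cB, hcB, hleB⟩ := exists_forall_volume_slice_le hB
  obtain ⟨cC, hcC, hleC⟩ := exists_forall_volume_slice_le hC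
  have key : ∀ t ∈ Set.Ioo (0 : ℝ) 1,
      volume {x | t * a < (volume (Prod.mk x ⁻¹' A)).toReal} +
        volume {x | t * b < (volume (Prod.mk x ⁻¹' B)).toReal} ≤
      volume {x | t * (a + b) < (volume (Prod.mk x ⁻¹' (A + B))).toReal} := by
    intro t ht
    refine (volume_add_volume_le_volume_add (measurableSet_lt measurable_const mF)
      (measurableSet_lt measurable_const mG) (hFa' _ (by nlinarith [ht.2]))
      (hGb' _ (by nlinarith [ht.2]))).trans (measure_mono ?_)
    rintro _ ⟨x, hx, y, hy, rfl⟩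
    simp only [Set.mem_ofPred_eq] at hx hy ⊢
    have nonempty_of_pos : ∀ {S : Set ℝ}, 0 < (volume S).toReal → S.Nonempty := by
      intro S hS
      by_contra! hemp
      simp [hemp] at hS
    have h1 := volume_add_volume_le_volume_add
      (hA.measurableSet.preimage (measurable_prodMk_left (x := x)))
      (hB.measurableSet.preimage (measurable_prodMk_left (x := y)))
      (nonempty_of_pos ((mul_pos ht.1 ha).trans hx))
      (nonempty_of_pos ((mul_pos ht.1 hb).trans hy))
    have h2 : (Prod.mk x ⁻¹' A) + (Prod.mk y ⁻¹' B) ⊆ Prod.mk (x + y) ⁻¹' (A + B) := by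
      rintro _ ⟨u, hu, v, hv, rfl⟩
      exact ⟨(x, u), hu, (y, v), hv, rfl⟩
    have h3 := ENNReal.toReal_mono (ne_top_of_le_ne_top hcC (hleC (x + y)))
      (h1.trans (measure_mono h2))
    rw [ENNReal.toReal_add (ne_top_of_le_ne_top hcA (hleA x))
      (ne_top_of_le_ne_top hcB (hleB y))] at h3
    linarith
  have key2 := (le_lintegral_add _ _).trans
    (setLIntegral_mono_ae' (μ := volume) measurableSet_Ioo (Filter.Eventually.of_forall key))
  generalize ∫⁻ t in Set.Ioo (0 : ℝ) 1,
    volume {x | t * a < (volume (Prod.mk x ⁻¹' A)).toReal} = p at iF key2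
  generalize ∫⁻ t in Set.Ioo (0 : ℝ) 1,
    volume {x | t * b < (volume (Prod.mk x ⁻¹' B)).toReal} = q at iG key2
  have hfin : ENNReal.ofReal (a + b) * (p + q) ≤ volume (A + B) := by
    refine le_trans ?_ iH
    gcongr
  have hsum : ENNReal.ofReal (a + b) ≠ 0 := by simpa using add_pos ha hb
  have hpq : p + q ≠ ⊤ := by
    intro htop
    rw [htop, ENNReal.mul_top hsum, top_le_iff] at hfin
    exact hC.measure_ne_top hfin
  have hp : p ≠ ⊤ := fun hh => hpq (by simp [hh])
  have hq : q ≠ ⊤ := fun hh => hpq (by simp [hh])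
  refine le_trans ?_ hfin
  rw [← hAB] at iG
  have hVtop : volume A ≠ ⊤ := hA.measure_ne_top
  lift p to NNReal using hp
  lift q to NNReal using hq
  rw [← ENNReal.ofReal_toReal hVtop] at iF iG ⊢
  rw [← ENNReal.ofReal_coe_nnreal, ← ENNReal.ofReal_mul ha.le,
    ENNReal.ofReal_le_ofReal_iff (by positivity)] at iF
  rw [← ENNReal.ofReal_coe_nnreal, ← ENNReal.ofReal_mul hb.le,
    ENNReal.ofReal_le_ofReal_iff (by positivity)] at iG
  rw [← ENNReal.ofReal_ofNat, ← ENNReal.ofReal_mul (by positivity), ← ENNReal.coe_add,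
    ← ENNReal.ofReal_coe_nnreal, ← ENNReal.ofReal_mul (by positivity)]
  refine ENNReal.ofReal_le_ofReal ?_
  rw [NNReal.coe_add]
  set v := (volume A).toReal
  have hv : 0 ≤ v := ENNReal.toReal_nonneg
  have h1 : v / a ≤ p := by rw [div_le_iff₀ ha]; linarith
  have h2 : v / b ≤ q := by rw [div_le_iff₀ hb]; linarith
  have h3 : 4 * v ≤ (a + b) * (v / a + v / b) := by
    have : (a + b) * (v / a + v / b) - 4 * v = v * (a - b) ^ 2 / (a * b) := by
      field_simp
      ring
    have : 0 ≤ v * (a - b) ^ 2 / (a * b) := by positivity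
    linarith
  refine h3.trans ?_
  gcongr

open scoped Pointwise in
theorem Complex.four_mul_volume_le_volume_add {A B : Set ℂ} (hA : IsCompact A) (hB : IsCompact B)
    (hAB : volume A = volume B) : 4 * volume A ≤ volume (A + B) := by
  have hv : ∀ S : Set ℂ, volume (equivRealProdCLM '' S) = volume S := by
    intro S
    have h1 := Complex.volume_preserving_equiv_real_prod.symm.measure_preimage_equiv S
    rw [← h1]
    congr 1
    exact Complex.equivRealProd.image_eq_preimage_symm S
  have h2 := _root_.four_mul_volume_le_volume_add (hA.image equivRealProdCLM.continuous)
    (hB.image equivRealProdCLM.continuous) (by rw [hv, hv, hAB])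
  rwa [← Set.image_add, hv, hv] at h2

open scoped Pointwise in
theorem volume_le_volume_image_midpoint {A : Set ℂ} (hA : IsCompact A) {c : ℂ} (hc : ‖c‖ = 1) :
    volume A ≤ volume ((fun p : ℂ × ℂ => (p.1 + c * p.2) / 2) '' A ×ˢ A) := by
  have hrot : volume ((fun z => c * z) '' A) = volume A := by
    have hc0 : c ≠ 0 := by
      rintro rfl
      simp at hc
    obtain ⟨C, rfl⟩ : ∃ C : Circle, (C : ℂ) = c := ⟨⟨c, by simp [Submonoid.unitSphere, hc]⟩, rfl⟩
    have h2 := (rotation C).measurePreserving.measure_preimage_emb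
      (rotation C).toHomeomorph.measurableEmbedding ((fun z => (C : ℂ) * z) '' A)
    rw [← h2]
    congr 1
    ext z
    rw [Set.mem_preimage, rotation_apply]
    exact ⟨fun ⟨x, hx, hxz⟩ => mul_left_cancel₀ hc0 hxz ▸ hx, fun hz => ⟨z, hz, rfl⟩⟩
  have h3 := Complex.four_mul_volume_le_volume_add hA (hA.image (continuous_const_mul c))
    hrot.symm
  have h4 : (fun p : ℂ × ℂ => (p.1 + c * p.2) / 2) '' A ×ˢ A =
      (1 / 2 : ℝ) • (A + (fun z => c * z) '' A) := by
    ext w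
    constructor
    · rintro ⟨⟨p, q⟩, ⟨hp, hq⟩, rfl⟩
      refine ⟨p + c * q, ⟨p, hp, c * q, ⟨q, hq, rfl⟩, rfl⟩, ?_⟩
      simp
      ring
    · rintro ⟨_, ⟨p, hp, _, ⟨q, hq, rfl⟩, rfl⟩, rfl⟩
      refine ⟨⟨p, q⟩, ⟨hp, hq⟩, ?_⟩
      simp
      ring
  rw [h4, Measure.addHaar_smul, Complex.finrank_real_complex]
  calc volume A = ENNReal.ofReal |(1 / 2 : ℝ) ^ 2| * (4 * volume A) := by
        rw [← mul_assoc, ← ENNReal.ofReal_ofNat, ← ENNReal.ofReal_mul (by positivity)]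
        norm_num
    _ ≤ _ := by gcongr

/-- Dyadic averages of `φ` over the angles `β + π j / 2 ^ (k - 1)`, for `0 ≤ j < 2 ^ k`. -/
noncomputable def dyadicMean : ℕ → (ℝ → ℝ) → ℝ → ℝ
  | 0, φ, β => φ β
  | k + 1, φ, β => (dyadicMean k φ β + dyadicMean k φ (β + Real.pi / 2 ^ k)) / 2

theorem exists_compact_support_le_dyadicMean {K : Set ℂ} (hK : IsCompact K) {s : ℝ → ℝ}
    (hs : ∀ w ∈ K, ∀ β : ℝ, (exp (-(β * I)) * w).re ≤ s β) (k : ℕ) :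
    ∃ A : Set ℂ, IsCompact A ∧ volume K ≤ volume A ∧
      ∀ w ∈ A, ∀ β : ℝ, (exp (-(β * I)) * w).re ≤ dyadicMean k s β := by
  induction k with
  | zero => exact ⟨K, hK, le_rfl, hs⟩
  | succ k ih =>
    obtain ⟨A, hA, hvol, hle⟩ := ih
    have hc : ‖exp (((-(Real.pi / 2 ^ k) : ℝ) : ℂ) * I)‖ = 1 := norm_exp_ofReal_mul_I _
    refine ⟨_, (hA.prod hA).image (by fun_prop), hvol.trans (volume_le_volume_image_midpoint hA hc),
      ?_⟩
    rintro _ ⟨⟨p, q⟩, ⟨hp, hq⟩, rfl⟩ β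
    have h1 := hle p hp β
    have h2 := hle q hq (β + Real.pi / 2 ^ k)
    have h3 : exp (-(β * I)) * ((p + exp (((-(Real.pi / 2 ^ k) : ℝ) : ℂ) * I) * q) / 2) =
        (exp (-(β * I)) * p + exp (-(((β + Real.pi / 2 ^ k : ℝ) : ℂ) * I)) * q) / 2 := by
      have : exp (-(((β + Real.pi / 2 ^ k : ℝ) : ℂ) * I)) =
          exp (-(β * I)) * exp (((-(Real.pi / 2 ^ k) : ℝ) : ℂ) * I) := by
        rw [← exp_add]
        push_cast
        ring_nf
      rw [this]
      ring
    simp only [dyadicMean]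
    rw [h3, show (2 : ℂ) = ((2 : ℝ) : ℂ) by norm_num, div_ofReal_re, add_re]
    linarith

theorem exists_le_dyadicMean {K : Set ℂ} (hK : IsCompact K) {s : ℝ → ℝ}
    (hs : ∀ w ∈ K, ∀ β : ℝ, (exp (-(β * I)) * w).re ≤ s β) {r : ℝ} (hr : 0 < r)
    (hvol : ENNReal.ofReal (Real.pi * r ^ 2) ≤ volume K) (k : ℕ) :
    ∃ β, r ≤ dyadicMean k s β := by
  obtain ⟨A, hA, hKA, hle⟩ := exists_compact_support_le_dyadicMean hK hs k
  have hvA := hvol.trans hKA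
  have hne : A.Nonempty := by
    by_contra! hemp
    have : 0 < Real.pi * r ^ 2 := by positivity
    simp [hemp] at hvA
    linarith
  obtain ⟨w, hw, hmax⟩ := hA.exists_isMaxOn hne continuous_norm.continuousOn
  have hrw : r ≤ ‖w‖ := by
    by_contra! hlt
    have hsub : A ⊆ closedBall 0 ‖w‖ := fun x hx => by simpa using hmax hx
    have := hvA.trans (measure_mono hsub)
    rw [Complex.volume_closedBall, ← ENNReal.ofReal_pow (norm_nonneg _), ← NNReal.coe_real_pi,
      ← ENNReal.ofReal_coe_nnreal, ← ENNReal.ofReal_mul (by positivity),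
      ENNReal.ofReal_le_ofReal_iff (by positivity)] at this
    have hpi := Real.pi_pos
    simp only [NNReal.coe_real_pi] at this
    have h2 : ‖w‖ ^ 2 < r ^ 2 := by gcongr
    nlinarith
  refine ⟨arg w, hrw.trans ((le_of_eq ?_).trans (hle w hw (arg w)))⟩
  have h1 : exp (-(arg w * I)) * w = (‖w‖ : ℂ) := by
    calc exp (-(arg w * I)) * w = exp (-(arg w * I)) * (‖w‖ * exp (arg w * I)) := by
          rw [norm_mul_exp_arg_mul_I w]
      _ = ‖w‖ := by rw [mul_left_comm, ← exp_add, neg_add_cancel, exp_zero, mul_one]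
  rw [h1, ofReal_re]

theorem circleAverage_const_mul (a : ℝ) (F : ℂ → ℝ) (c : ℂ) (R : ℝ) :
    Real.circleAverage (fun ζ => a * F ζ) c R = a * Real.circleAverage F c R := by
  simpa only [smul_eq_mul] using Real.circleAverage_fun_smul (a := a) (f := F)

theorem circleAverage_poissonKernel_mul_re {Φ : ℂ → ℂ} (hΦ : DifferentiableOn ℂ Φ (ball 0 1))
    {R : ℝ} (hR1 : R < 1) {w : ℂ} (hw : ‖w‖ < R) :
    Real.circleAverage (fun ζ => poissonKernel 0 w ζ * (Φ ζ).re) 0 R = (Φ w).re := by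
  have hharm : InnerProductSpace.HarmonicOnNhd (fun ζ => (Φ ζ).re) (closedBall 0 R) := by
    intro x hx
    refine AnalyticAt.harmonicAt_re (hΦ.analyticAt (isOpen_ball.mem_nhds ?_))
    exact closedBall_subset_ball hR1 hx
  exact hharm.circleAverage_poissonKernel_smul (by simpa using hw)

theorem continuousOn_poissonKernel_sphere {R : ℝ} {w : ℂ} (hw : ‖w‖ < R) :
    ContinuousOn (poissonKernel 0 w) (sphere 0 R) := by
  have : poissonKernel 0 w = fun z => (‖z‖ ^ 2 - ‖w‖ ^ 2) / ‖z - w‖ ^ 2 := by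
    ext z
    simp [poissonKernel_def]
  rw [this]
  refine ContinuousOn.div (by fun_prop) (by fun_prop) fun z hz => ?_
  have hz' : ‖z‖ = R := by simpa using hz
  have : z - w ≠ 0 := by
    intro h0
    rw [sub_eq_zero.1 h0] at hz'
    exact absurd hz' hw.ne
  positivity

theorem circleAverage_poissonKernel {R : ℝ} (hR1 : R < 1) {w : ℂ} (hw : ‖w‖ < R) :
    Real.circleAverage (poissonKernel 0 w) 0 R = 1 := by
  simpa using circleAverage_poissonKernel_mul_re (differentiableOn_const (1 : ℂ)) hR1 hw

theorem sq_sub_le_mul_sub_log {d q : ℝ} (hd : 0 < d) (hq : 0 < q) (hd4 : d ≤ 4) (hq4 : q ≤ 4) :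
    (d - q) ^ 2 ≤ 64 * (d / q - 1 - (Real.log d - Real.log q)) := by
  obtain ⟨x, hx, hxd⟩ : ∃ x : ℝ, 0 < x ∧ x ^ 2 = d / q :=
    ⟨√(d / q), Real.sqrt_pos.2 (by positivity), Real.sq_sqrt (by positivity)⟩
  have hlog : Real.log d - Real.log q ≤ 2 * (x - 1) := by
    rw [← Real.log_div hd.ne' hq.ne', ← hxd, Real.log_pow]
    push_cast
    linarith [Real.log_le_sub_one_of_pos hx]
  have hdq : d = q * x ^ 2 := by rw [hxd]; field_simp
  have h1 : (q * (x + 1)) ^ 2 ≤ 8 ^ 2 := by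
    have : q * x ≤ 4 := abs_le_of_sq_le_sq' (by nlinarith) (by norm_num) |>.2
    gcongr
    linarith
  rw [← hxd]
  calc (d - q) ^ 2 = (q * (x + 1)) ^ 2 * (x - 1) ^ 2 := by rw [hdq]; ring
    _ ≤ 8 ^ 2 * (x - 1) ^ 2 := by gcongr
    _ ≤ _ := by nlinarith

theorem norm_sub_sq_eq_mul {r R : ℝ} (hr : 0 < r) (hR : 0 < R) {z ζ : ℂ} (hz : ‖z‖ = r)
    (hζ : ‖ζ‖ = R) :
    ‖ζ - z‖ ^ 2 =
      R ^ 2 * (1 + (r / R) ^ 2 - 2 * (r / R) * (((starRingEnd ℂ) z / r * ζ).re / R)) := by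
  have h1 : ((starRingEnd ℂ) z / r * ζ).re = (ζ * (starRingEnd ℂ) z).re / r := by
    rw [div_mul_eq_mul_div, div_ofReal_re, mul_comm]
  rw [← normSq_eq_norm_sq, normSq_sub, normSq_eq_norm_sq, normSq_eq_norm_sq, hζ, hz, h1]
  field_simp

/-- The defect in the weighted logarithmic inequality controls the mean square distance of a
bounded harmonic function to a linear one. -/
theorem circleAverage_sq_le_log_defect {Φ : ℂ → ℂ} (hΦ : DifferentiableOn ℂ Φ (ball 0 1))
    (hbd : ∀ ζ ∈ ball (0 : ℂ) 1, |(Φ ζ).re| ≤ 1) {r R : ℝ} (hr : 0 < r) (hrR : r < R) (hR1 : R < 1)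
    {z : ℂ} (hz : ‖z‖ = r) :
    (r / R) ^ 2 * Real.circleAverage
        (fun ζ => (Φ ζ - (starRingEnd ℂ) z / r * ζ / R).re ^ 2) 0 R ≤
      16 * ((1 + (r / R) ^ 2 - 2 * (r / R) * (Φ z).re) / (1 - (r / R) ^ 2) - 1 -
        Real.circleAverage
          (fun ζ => Real.log (1 + (r / R) ^ 2 - 2 * (r / R) * (Φ ζ).re)) 0 R) := by
  have hR : 0 < R := hr.trans hrR
  have hsub : sphere (0 : ℂ) R ⊆ ball 0 1 := fun x hx => by
    simpa using (show ‖x‖ = R by simpa using hx).trans_lt hR1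
  have hΦc : ContinuousOn Φ (sphere 0 R) := (hΦ.mono hsub).continuousOn
  have hz' : ‖z‖ < R := hz.trans_lt hrR
  have hPc := continuousOn_poissonKernel_sphere hz'
  set t := r / R with ht
  have ht0 : 0 < t := by positivity
  have ht1 : t < 1 := (div_lt_one hR).2 hrR
  have ht2 : 0 < 1 - t ^ 2 := by nlinarith
  have hdpos : ∀ x : ℝ, |x| ≤ 1 → 0 < 1 + t ^ 2 - 2 * t * x ∧ 1 + t ^ 2 - 2 * t * x ≤ 4 := by
    intro x hx
    obtain ⟨h1, h2⟩ := abs_le.1 hx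
    constructor <;> nlinarith
  have hlogc : ContinuousOn (fun ζ => Real.log (1 + t ^ 2 - 2 * t * (Φ ζ).re)) (sphere 0 R) := by
    refine ContinuousOn.log (by fun_prop) fun x hx => (hdpos _ (hbd x (hsub hx))).1.ne'
  have hlogz : Continuous (fun ζ : ℂ => ‖ζ - z‖) := by fun_prop
  have hzne : ∀ x ∈ sphere (0 : ℂ) R, ‖x - z‖ ≠ 0 := by
    intro x hx h0
    rw [norm_eq_zero, sub_eq_zero] at h0
    subst h0
    simp only [mem_sphere_iff_norm, sub_zero] at hx
    linarith
  have hlogzc : ContinuousOn (fun ζ => Real.log ‖ζ - z‖) (sphere 0 R) :=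
    hlogz.continuousOn.log hzne
  have hlogavg : Real.circleAverage (fun ζ => Real.log ‖ζ - z‖) 0 R = Real.log R :=
    circleAverage_log_norm_sub_const_of_mem_closedBall
      (by simpa [abs_of_pos hR] using hz'.le)
  have ci : ∀ {F : ℂ → ℝ}, ContinuousOn F (sphere 0 R) → CircleIntegrable F 0 R :=
    fun hF => hF.circleIntegrable hR.le
  have hpt : ∀ ζ ∈ sphere (0 : ℂ) |R|,
      (4 * t ^ 2) * (Φ ζ - (starRingEnd ℂ) z / r * ζ / R).re ^ 2 ≤
        64 * (((1 + t ^ 2) / (1 - t ^ 2) * poissonKernel 0 z ζ -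
          2 * t / (1 - t ^ 2) * (poissonKernel 0 z ζ * (Φ ζ).re)) - (1 + 2 * Real.log R) -
          (Real.log (1 + t ^ 2 - 2 * t * (Φ ζ).re) - 2 * Real.log ‖ζ - z‖)) := by
    intro ζ hζ
    rw [abs_of_pos hR] at hζ
    have hζ' : ‖ζ‖ = R := by simpa using hζ
    have hq := norm_sub_sq_eq_mul hr hR hz hζ'
    rw [← ht] at hq
    set y := ((starRingEnd ℂ) z / r * ζ).re / R with hy
    have hy1 : |y| ≤ 1 := by
      rw [hy, abs_div, abs_of_pos hR, div_le_one hR]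
      refine (abs_re_le_norm _).trans ?_
      rw [norm_mul, norm_div, norm_conj, hz, hζ', norm_real, Real.norm_of_nonneg hr.le,
        div_self hr.ne', one_mul]
    have hd := hdpos _ (hbd ζ (hsub hζ))
    have hqp := hdpos _ hy1
    have hmain := sq_sub_le_mul_sub_log hd.1 hqp.1 hd.2 hqp.2
    have hP : poissonKernel 0 z ζ = (1 - t ^ 2) / (1 + t ^ 2 - 2 * t * y) := by
      rw [poissonKernel_def]
      simp only [sub_zero]
      rw [hq, hζ', hz, show r = t * R by rw [ht]; field_simp]
      field_simp
    have hlq : Real.log (1 + t ^ 2 - 2 * t * y) = 2 * Real.log ‖ζ - z‖ - 2 * Real.log R := by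
      have h1 := congrArg Real.log hq
      rw [Real.log_mul (by positivity) hqp.1.ne', Real.log_pow, Real.log_pow] at h1
      push_cast at h1
      linarith
    have hv : (Φ ζ - (starRingEnd ℂ) z / r * ζ / R).re = (Φ ζ).re - y := by
      rw [sub_re, div_ofReal_re]
    rw [hv, hP]
    rw [hlq] at hmain
    have hq0 := hqp.1.ne'
    have e1 : ((1 + t ^ 2) / (1 - t ^ 2) * ((1 - t ^ 2) / (1 + t ^ 2 - 2 * t * y)) -
        2 * t / (1 - t ^ 2) * ((1 - t ^ 2) / (1 + t ^ 2 - 2 * t * y) * (Φ ζ).re)) =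
        (1 + t ^ 2 - 2 * t * (Φ ζ).re) / (1 + t ^ 2 - 2 * t * y) := by
      field_simp
    rw [e1]
    nlinarith
  have hmono := Real.circleAverage_mono (ci (by fun_prop)) (ci (by fun_prop)) hpt
  have cP := ci hPc
  have cPu : CircleIntegrable (fun ζ => poissonKernel 0 z ζ * (Φ ζ).re) 0 R := ci (by fun_prop)
  have cl := ci hlogc
  have clz := ci hlogzc
  rw [circleAverage_const_mul, circleAverage_const_mul,
    Real.circleAverage_fun_sub (ci (by fun_prop)) (ci (by fun_prop)),
    Real.circleAverage_fun_sub (ci (by fun_prop)) (ci (by fun_prop)),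
    Real.circleAverage_fun_sub (ci (by fun_prop)) (ci (by fun_prop)),
    Real.circleAverage_fun_sub (ci (by fun_prop)) (ci (by fun_prop)),
    Real.circleAverage_const] at hmono
  rw [circleAverage_const_mul, circleAverage_const_mul, circleAverage_const_mul, hlogavg,
    circleAverage_poissonKernel hR1 hz',
    circleAverage_poissonKernel_mul_re hΦ hR1 hz'] at hmono
  have e2 : (1 + t ^ 2) / (1 - t ^ 2) * 1 - 2 * t / (1 - t ^ 2) * (Φ z).re =
    (1 + t ^ 2 - 2 * t * (Φ z).re) / (1 - t ^ 2) := by ring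
  rw [e2] at hmono
  linarith

/-- Pointwise bound for a harmonic function in terms of its mean square on a circle. -/
theorem abs_re_le_of_circleAverage_sq {Ψ : ℂ → ℂ} (hΨ : DifferentiableOn ℂ Ψ (ball 0 1))
    {R : ℝ} (hR1 : R < 1) {w : ℂ} (hw : ‖w‖ < R) {l : ℝ} (hl : 0 < l) :
    |(Ψ w).re| ≤ l / 2 + (R + ‖w‖) / (R - ‖w‖) / (2 * l) *
      Real.circleAverage (fun ζ => (Ψ ζ).re ^ 2) 0 R := by
  have hR : 0 < R := (norm_nonneg w).trans_lt hw
  have hsub : sphere (0 : ℂ) R ⊆ ball 0 1 := fun x hx => by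
    simpa using (show ‖x‖ = R by simpa using hx).trans_lt hR1
  have hΨc : ContinuousOn Ψ (sphere 0 R) := (hΨ.mono hsub).continuousOn
  have hPc := continuousOn_poissonKernel_sphere hw
  have ci : ∀ {F : ℂ → ℝ}, ContinuousOn F (sphere 0 R) → CircleIntegrable F 0 R :=
    fun hF => hF.circleIntegrable hR.le
  set C := (R + ‖w‖) / (R - ‖w‖) with hC
  have hpt : ∀ ζ ∈ sphere (0 : ℂ) |R|, |fun ζ => poissonKernel 0 w ζ * (Ψ ζ).re| ζ ≤
      l / 2 * poissonKernel 0 w ζ + C / (2 * l) * (Ψ ζ).re ^ 2 := by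
    intro ζ hζ
    rw [abs_of_pos hR] at hζ
    have hPle : poissonKernel 0 w ζ ≤ C := by
      rw [poissonKernel_eq_re_herglotzRieszKernel]
      simpa [herglotzRieszKernel_def] using re_herglotzRieszKernel_le hζ
        (show w ∈ ball 0 R by simpa using hw)
    have hP0 : 0 ≤ poissonKernel 0 w ζ := by
      rw [poissonKernel_def]
      have hζ' : ‖ζ‖ = R := by simpa using hζ
      simp only [sub_zero, hζ']
      have := norm_nonneg w
      exact div_nonneg (by nlinarith) (by positivity)
    rw [Pi.abs_apply, abs_mul, abs_of_nonneg hP0]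
    have h1 : |(Ψ ζ).re| ≤ l / 2 + 1 / (2 * l) * (Ψ ζ).re ^ 2 := by
      have e : l / 2 + 1 / (2 * l) * (Ψ ζ).re ^ 2 - |(Ψ ζ).re| =
          (|(Ψ ζ).re| - l) ^ 2 / (2 * l) := by
        rw [← sq_abs (Ψ ζ).re]
        field_simp
        ring
      have : 0 ≤ (|(Ψ ζ).re| - l) ^ 2 / (2 * l) := by positivity
      linarith
    calc poissonKernel 0 w ζ * |(Ψ ζ).re|
        ≤ poissonKernel 0 w ζ * (l / 2 + 1 / (2 * l) * (Ψ ζ).re ^ 2) := by gcongr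
      _ = l / 2 * poissonKernel 0 w ζ +
          poissonKernel 0 w ζ / (2 * l) * (Ψ ζ).re ^ 2 := by ring
      _ ≤ _ := by gcongr
  calc |(Ψ w).re|
      = |Real.circleAverage (fun ζ => poissonKernel 0 w ζ * (Ψ ζ).re) 0 R| := by
        rw [circleAverage_poissonKernel_mul_re hΨ hR1 hw]
    _ ≤ _ := Real.abs_circleAverage_le_circleAverage_abs
    _ ≤ _ := Real.circleAverage_mono (ci (ContinuousOn.abs (by fun_prop))) (ci (by fun_prop)) hpt
    _ = _ := by
      rw [Real.circleAverage_fun_add (ci (by fun_prop)) (ci (by fun_prop)),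
        circleAverage_const_mul, circleAverage_const_mul,
        circleAverage_poissonKernel hR1 hw, mul_one]

theorem dyadicMean_mono (k : ℕ) {φ ψ : ℝ → ℝ} (hle : ∀ α, φ α ≤ ψ α) (β : ℝ) :
    dyadicMean k φ β ≤ dyadicMean k ψ β := by
  induction k generalizing β with
  | zero => exact hle β
  | succ k ih =>
    simp only [dyadicMean]
    linarith [ih β, ih (β + Real.pi / 2 ^ k)]

theorem dyadicMean_const_sub_mul_sub (k : ℕ) (A B : ℝ) (s m : ℝ → ℝ) (β : ℝ) :
    dyadicMean k (fun α => A - B * s α - m α) β =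
      A - B * dyadicMean k s β - dyadicMean k m β := by
  induction k generalizing β with
  | zero => rfl
  | succ k ih =>
    simp only [dyadicMean, ih]
    ring

theorem dyadicMean_circleAverage (k : ℕ) {F : ℝ → ℂ → ℝ} {c : ℂ} {R : ℝ}
    (hF : ∀ α, CircleIntegrable (F α) c R) (β : ℝ) :
    CircleIntegrable (fun ζ => dyadicMean k (fun α => F α ζ) β) c R ∧
      dyadicMean k (fun α => Real.circleAverage (F α) c R) β =
        Real.circleAverage (fun ζ => dyadicMean k (fun α => F α ζ) β) c R := by
  induction k generalizing β with
  | zero => exact ⟨hF β, rfl⟩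
  | succ k ih =>
    obtain ⟨h1, h2⟩ := ih β
    obtain ⟨h3, h4⟩ := ih (β + Real.pi / 2 ^ k)
    have h5 : (fun ζ => dyadicMean (k + 1) (fun α => F α ζ) β) = fun ζ => (1 / 2 : ℝ) *
        (dyadicMean k (fun α => F α ζ) β +
          dyadicMean k (fun α => F α ζ) (β + Real.pi / 2 ^ k)) := by
      ext ζ
      simp only [dyadicMean]
      ring
    rw [h5]
    refine ⟨(h1.add h3).const_mul _, ?_⟩
    rw [circleAverage_const_mul, Real.circleAverage_fun_add h1 h3, ← h2, ← h4]
    simp only [dyadicMean]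
    ring

theorem dyadicMean_log_norm_one_sub (k : ℕ) {w : ℂ} (hw : ‖w‖ < 1) (β : ℝ) :
    dyadicMean k (fun α => Real.log ‖1 - exp (-(α * I)) * w‖) β =
      1 / 2 ^ k * Real.log ‖1 - (exp (-(β * I)) * w) ^ 2 ^ k‖ := by
  induction k generalizing β with
  | zero => simp [dyadicMean]
  | succ k ih =>
    simp only [dyadicMean, ih]
    have h1 : (exp (-(((β + Real.pi / 2 ^ k : ℝ) : ℂ) * I)) * w) ^ 2 ^ k =
        -(exp (-(β * I)) * w) ^ 2 ^ k := by
      have h2 : exp (-(((β + Real.pi / 2 ^ k : ℝ) : ℂ) * I)) =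
          exp (-(β * I)) * exp (-((Real.pi / 2 ^ k : ℝ) * I)) := by
        rw [← exp_add]
        push_cast
        ring_nf
      have h3 : exp (-(((Real.pi / 2 ^ k : ℝ) : ℂ) * I)) ^ 2 ^ k = -1 := by
        rw [← exp_nat_mul, ← exp_neg_pi_mul_I]
        congr 1
        push_cast
        field_simp
      rw [h2, mul_right_comm, mul_pow _ (exp _), h3]
      ring
    rw [h1]
    set y := (exp (-(β * I)) * w) ^ 2 ^ k with hy
    have hy1 : ‖y‖ < 1 := by
      rw [hy, norm_pow, norm_mul, show (-(β * I) : ℂ) = ((-β : ℝ) : ℂ) * I by push_cast; ring,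
        norm_exp_ofReal_mul_I, one_mul]
      exact pow_lt_one₀ (norm_nonneg w) hw (by positivity)
    have hne1 : ‖1 - y‖ ≠ 0 := by
      rw [norm_ne_zero_iff, sub_ne_zero]
      rintro h1
      simp [← h1] at hy1
    have hne2 : ‖1 - -y‖ ≠ 0 := by
      rw [norm_ne_zero_iff, sub_ne_zero]
      intro h1
      rw [← norm_neg, ← h1] at hy1
      simp at hy1
    have h4 : (exp (-(β * I)) * w) ^ 2 ^ (k + 1) = y ^ 2 := by rw [hy, ← pow_mul, pow_succ]
    rw [h4, show (1 : ℂ) - y ^ 2 = (1 - y) * (1 - -y) by ring, norm_mul, Real.log_mul hne1 hne2]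
    rw [pow_succ]
    field_simp

theorem norm_exp_neg_ofReal_mul_I (α : ℝ) : ‖exp (-(α * I))‖ = 1 := by
  rw [show (-(α * I) : ℂ) = ((-α : ℝ) : ℂ) * I by push_cast; ring, norm_exp_ofReal_mul_I]

theorem le_dyadicMean_log (k : ℕ) {w : ℂ} (hw : ‖w‖ ≤ 1) {t : ℝ} (ht0 : 0 < t) (ht1 : t < 1)
    (β : ℝ) :
    2 / 2 ^ k * Real.log (1 - t) ≤
      dyadicMean k (fun α => Real.log (1 + t ^ 2 - 2 * t * (exp (-(α * I)) * w).re)) β := by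
  have htw : ‖(t : ℂ) * w‖ ≤ t := by
    rw [norm_mul, norm_real, Real.norm_of_nonneg ht0.le]
    nlinarith
  have hE : ∀ α : ℝ, ‖exp (-(α * I)) * (t * w)‖ ≤ t := fun α => by
    rw [norm_mul, norm_exp_neg_ofReal_mul_I, one_mul]
    exact htw
  have key : ∀ α : ℝ, 0 - (-2) * Real.log ‖1 - exp (-(α * I)) * (t * w)‖ - 0 ≤
      Real.log (1 + t ^ 2 - 2 * t * (exp (-(α * I)) * w).re) := by
    intro α
    have hpos : 0 < ‖1 - exp (-(α * I)) * (t * w)‖ := by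
      have := norm_sub_norm_le (1 : ℂ) (exp (-(α * I)) * (t * w))
      rw [norm_one] at this
      linarith [hE α]
    have h1 : ‖1 - exp (-(α * I)) * (t * w)‖ ^ 2 ≤
        1 + t ^ 2 - 2 * t * (exp (-(α * I)) * w).re := by
      rw [← normSq_eq_norm_sq, normSq_sub, normSq_eq_norm_sq, normSq_eq_norm_sq, norm_one]
      have h2 : (1 * (starRingEnd ℂ) (exp (-(α * I)) * (t * w))).re =
          t * (exp (-(α * I)) * w).re := by
        rw [one_mul, conj_re, mul_left_comm, re_ofReal_mul]
      rw [h2]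
      nlinarith [hE α, norm_nonneg (exp (-(α * I)) * (t * w))]
    have h3 := Real.log_le_log (by positivity) h1
    rw [Real.log_pow] at h3
    push_cast at h3
    linarith
  have h4 := dyadicMean_mono k key β
  rw [dyadicMean_const_sub_mul_sub, dyadicMean_log_norm_one_sub k (htw.trans_lt ht1)] at h4
  have h0 : dyadicMean k (fun _ => (0 : ℝ)) β = 0 := by
    have := dyadicMean_const_sub_mul_sub k 0 0 (fun _ => 0) (fun _ => 0) β
    simp at this
    linarith
  rw [h0] at h4
  refine le_trans ?_ h4
  have h5 : 1 - t ≤ ‖1 - (exp (-(β * I)) * (t * w)) ^ 2 ^ k‖ := by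
    have h6 := norm_sub_norm_le (1 : ℂ) ((exp (-(β * I)) * (t * w)) ^ 2 ^ k)
    have h7 : ‖(exp (-(β * I)) * (t * w)) ^ 2 ^ k‖ ≤ t := by
      rw [norm_pow]
      exact (pow_le_of_le_one (norm_nonneg _) ((hE β).trans ht1.le) (by positivity)).trans (hE β)
    rw [norm_one] at h6
    linarith
  have h8 := Real.log_le_log (by linarith) h5
  have h9 : 0 < (2 : ℝ) / 2 ^ k := by positivity
  calc 2 / 2 ^ k * Real.log (1 - t)
      ≤ 2 / 2 ^ k * Real.log ‖1 - (exp (-(β * I)) * (t * w)) ^ 2 ^ k‖ := by gcongr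
    _ = _ := by ring

theorem exists_add_le_of_dyadicMean_le (k : ℕ) {φ : ℝ → ℝ} {β η : ℝ}
    (hle : dyadicMean (k + 2) φ β ≤ η) : ∃ α, φ α + φ (α + Real.pi / 2) ≤ 2 * η := by
  induction k generalizing β with
  | zero =>
    simp only [dyadicMean, pow_zero, div_one, pow_one] at hle
    rw [add_right_comm β (Real.pi / 2)] at hle
    by_contra! hlt
    linarith [hlt β, hlt (β + Real.pi)]
  | succ k ih =>
    rw [show k + 1 + 2 = (k + 2) + 1 by ring, dyadicMean] at hle
    by_cases h1 : dyadicMean (k + 2) φ β ≤ η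
    · exact ih h1
    · exact ih (β := β + Real.pi / 2 ^ (k + 2)) (by linarith)

theorem exists_norm_eq_forall_re_le {Φ : ℂ → ℂ} (hΦ : DifferentiableOn ℂ Φ (ball 0 1)) {r : ℝ}
    (hr0 : 0 < r) (hr1 : r < 1) :
    ∃ z : ℂ, ‖z‖ = r ∧ ∀ w ∈ closedBall (0 : ℂ) r, (Φ w).re ≤ (Φ z).re := by
  have hd : DifferentiableOn ℂ (fun z => exp (Φ z)) (closure (ball 0 r)) := by
    rw [closure_ball _ hr0.ne']
    exact (hΦ.mono (closedBall_subset_ball hr1)).cexp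
  obtain ⟨z, hz, hmax⟩ := Complex.exists_mem_frontier_isMaxOn_norm isBounded_ball
    (nonempty_ball.2 hr0) hd.diffContOnCl
  rw [frontier_ball _ hr0.ne'] at hz
  rw [closure_ball _ hr0.ne'] at hmax
  refine ⟨z, by simpa using hz, fun w hw => ?_⟩
  have := hmax hw
  simpa [norm_exp] using this

/-- A family of real parts of rotations of a harmonic map, in holomorphic form. -/
noncomputable def rotatedHolomorphic (h g : ℂ → ℂ) (α : ℝ) (z : ℂ) : ℂ :=
  exp (-(α * I)) * h z + exp (α * I) * g z

theorem re_rotatedHolomorphic (h g : ℂ → ℂ) (α : ℝ) (z : ℂ) :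
    (rotatedHolomorphic h g α z).re = (exp (-(α * I)) * (h z + (starRingEnd ℂ) (g z))).re := by
  have h1 : (starRingEnd ℂ) (exp (α * I) * g z) = exp (-(α * I)) * (starRingEnd ℂ) (g z) := by
    rw [map_mul, ← exp_conj, map_mul, conj_ofReal, conj_I, mul_neg]
  rw [rotatedHolomorphic, mul_add, add_re, add_re, ← h1, conj_re]

theorem differentiableOn_rotatedHolomorphic {h g : ℂ → ℂ} {s : Set ℂ}
    (hh : DifferentiableOn ℂ h s) (hg : DifferentiableOn ℂ g s) (α : ℝ) :
    DifferentiableOn ℂ (rotatedHolomorphic h g α) s :=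
  (hh.const_mul _).add (hg.const_mul _)

/-- There are two orthogonal directions in which the logarithmic defect is small. -/
theorem exists_orthogonal_log_defect_le {h g : ℂ → ℂ}
    (hh : DifferentiableOn ℂ h (ball (0 : ℂ) 1)) (hg : DifferentiableOn ℂ g (ball (0 : ℂ) 1))
    (hbd : ∀ z ∈ ball (0 : ℂ) 1, ‖h z + (starRingEnd ℂ) (g z)‖ ≤ 1) {r R : ℝ} (hr : 0 < r)
    (hrR : r < R) (hR1 : R < 1)
    (hvol : ENNReal.ofReal (Real.pi * r ^ 2) ≤
      volume ((fun z => h z + (starRingEnd ℂ) (g z)) '' closedBall (0 : ℂ) r))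
    {η : ℝ} (hη : 2 * (r / R) * (r / R - r) / (1 - (r / R) ^ 2) < η) :
    ∃ (α : ℝ) (z z' : ℂ), ‖z‖ = r ∧ ‖z'‖ = r ∧
      (r / R) ^ 2 * Real.circleAverage (fun ζ =>
        (rotatedHolomorphic h g α ζ - (starRingEnd ℂ) z / r * ζ / R).re ^ 2) 0 R ≤ 32 * η ∧
      (r / R) ^ 2 * Real.circleAverage (fun ζ =>
        (rotatedHolomorphic h g (α + Real.pi / 2) ζ -
          (starRingEnd ℂ) z' / r * ζ / R).re ^ 2) 0 R ≤ 32 * η := by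
  have hR : 0 < R := hr.trans hrR
  have hsub : sphere (0 : ℂ) R ⊆ ball 0 1 := fun x hx => by
    simpa using (show ‖x‖ = R by simpa using hx).trans_lt hR1
  have hr1 : r < 1 := hrR.trans hR1
  have hΦ := differentiableOn_rotatedHolomorphic hh hg
  have hub : ∀ α, ∀ ζ ∈ ball (0 : ℂ) 1, |(rotatedHolomorphic h g α ζ).re| ≤ 1 := by
    intro α ζ hζ
    rw [re_rotatedHolomorphic]
    refine (abs_re_le_norm _).trans ?_
    rw [norm_mul, norm_exp_neg_ofReal_mul_I, one_mul]
    exact hbd ζ hζ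
  choose z hz hzmax using fun α => exists_norm_eq_forall_re_le (hΦ α) hr hr1
  set s : ℝ → ℝ := fun α => (rotatedHolomorphic h g α (z α)).re with hs
  have hfc : ContinuousOn (fun z => h z + (starRingEnd ℂ) (g z)) (closedBall 0 r) :=
    (hh.continuousOn.add (continuous_conj.comp_continuousOn hg.continuousOn)).mono
      (closedBall_subset_ball hr1)
  have hL3 := exists_le_dyadicMean ((isCompact_closedBall (0 : ℂ) r).image_of_continuousOn hfc)
    (s := s) (by
      rintro _ ⟨w, hw, rfl⟩ α
      rw [← re_rotatedHolomorphic]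
      exact hzmax α w hw) hr hvol
  set t := r / R with ht
  have ht0 : 0 < t := by positivity
  have ht1 : t < 1 := (div_lt_one hR).2 hrR
  have ht2 : 0 < 1 - t ^ 2 := by nlinarith
  set m : ℝ → ℝ := fun α => Real.circleAverage
    (fun ζ => Real.log (1 + t ^ 2 - 2 * t * (rotatedHolomorphic h g α ζ).re)) 0 R with hm
  have hdefect := fun α => circleAverage_sq_le_log_defect (hΦ α) (hub α) hr hrR hR1 (hz α)
  have hci : ∀ α, CircleIntegrable
      (fun ζ => Real.log (1 + t ^ 2 - 2 * t * (rotatedHolomorphic h g α ζ).re)) 0 R := by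
    intro α
    refine ContinuousOn.circleIntegrable hR.le ?_
    have hc : ContinuousOn (rotatedHolomorphic h g α) (sphere 0 R) :=
      ((hΦ α).mono hsub).continuousOn
    refine ContinuousOn.log (continuousOn_const.sub
      (continuousOn_const.mul (continuous_re.comp_continuousOn hc))) fun x hx => ?_
    have := (abs_le.1 (hub α x (hsub hx))).2
    nlinarith
  obtain ⟨k, hk⟩ : ∃ k : ℕ, 2 / 2 ^ (k + 2) * -Real.log (1 - t) ≤
      η - 2 * t * (t - r) / (1 - t ^ 2) := by
    have hpos : 0 < η - 2 * t * (t - r) / (1 - t ^ 2) := by linarith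
    have h1 : Filter.Tendsto (fun k : ℕ => (1 / 2 : ℝ) ^ k * (-Real.log (1 - t) / 2))
        Filter.atTop (nhds (0 * (-Real.log (1 - t) / 2))) :=
      (tendsto_pow_atTop_nhds_zero_of_lt_one (by norm_num) (by norm_num)).mul_const _
    rw [zero_mul] at h1
    obtain ⟨k, hk⟩ := (h1.eventually (ge_mem_nhds hpos)).exists
    refine ⟨k, le_trans (le_of_eq ?_) hk⟩
    rw [one_div, inv_pow, pow_add]
    field_simp
  obtain ⟨β, hβ⟩ := hL3 (k + 2)
  set Δ : ℝ → ℝ := fun α =>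
    ((1 + t ^ 2) / (1 - t ^ 2) - 1) - 2 * t / (1 - t ^ 2) * s α - m α with hΔ
  have hΔeq : ∀ α, (1 + t ^ 2 - 2 * t * (rotatedHolomorphic h g α (z α)).re) / (1 - t ^ 2) - 1 -
      m α = Δ α := by
    intro α
    simp only [hΔ, hs]
    ring
  have hmean : dyadicMean (k + 2) Δ β ≤ η := by
    rw [hΔ, dyadicMean_const_sub_mul_sub]
    have h1 : 2 / 2 ^ (k + 2) * Real.log (1 - t) ≤ dyadicMean (k + 2) m β := by
      obtain ⟨h2, h3⟩ := dyadicMean_circleAverage (k + 2) hci β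
      rw [h3, ← Real.circleAverage_const (2 / 2 ^ (k + 2) * Real.log (1 - t)) 0 R]
      refine Real.circleAverage_mono (circleIntegrable_const _ _ _) h2 fun ζ hζ => ?_
      rw [abs_of_pos hR] at hζ
      simp only [re_rotatedHolomorphic]
      exact le_dyadicMean_log (k + 2) (hbd ζ (hsub hζ)) ht0 ht1 β
    have h4 : 2 * t / (1 - t ^ 2) * r ≤ 2 * t / (1 - t ^ 2) * dyadicMean (k + 2) s β := by
      gcongr
    have h5 : 2 * t * (t - r) / (1 - t ^ 2) =
        (1 + t ^ 2) / (1 - t ^ 2) - 1 - 2 * t / (1 - t ^ 2) * r := by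
      field_simp
      ring
    linarith
  obtain ⟨α, hα⟩ := exists_add_le_of_dyadicMean_le k hmean
  have hnn : ∀ α, 0 ≤ Real.circleAverage (fun ζ =>
      (rotatedHolomorphic h g α ζ - (starRingEnd ℂ) (z α) / r * ζ / R).re ^ 2) 0 R := fun α =>
    Real.circleAverage_nonneg_of_nonneg fun x _ => sq_nonneg _
  have hd1 := hdefect α
  have hd2 := hdefect (α + Real.pi / 2)
  have ht3 : 0 ≤ t ^ 2 := by positivity
  have p1 := mul_nonneg ht3 (hnn α)
  have p2 := mul_nonneg ht3 (hnn (α + Real.pi / 2))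
  rw [show (Real.circleAverage (fun ζ => Real.log
    (1 + t ^ 2 - 2 * t * (rotatedHolomorphic h g α ζ).re)) 0 R) = m α from rfl, hΔeq] at hd1
  rw [show (Real.circleAverage (fun ζ => Real.log
    (1 + t ^ 2 - 2 * t * (rotatedHolomorphic h g (α + Real.pi / 2) ζ).re)) 0 R) =
      m (α + Real.pi / 2) from rfl, hΔeq] at hd2
  exact ⟨α, z α, z (α + Real.pi / 2), hz _, hz _, by linarith, by linarith⟩

/-- Closeness to a linear functional, from smallness of the mean square defect. -/
theorem abs_re_sub_le_of_circleAverage_sq_le {Φ : ℂ → ℂ} (hΦ : DifferentiableOn ℂ Φ (ball 0 1))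
    {r R : ℝ} (hr : 0 < r) (hrR : r < R) (hR1 : R < 1) {ρ ε : ℝ} (hρ1 : ρ < 1)
    (hε : 0 < ε) (hρR : (1 + ρ) / 2 ≤ R) (hRε : 1 / R - 1 ≤ ε / 2)
    {b : ℂ} (hb : ‖b‖ = 1)
    (hle : (r / R) ^ 2 * Real.circleAverage (fun ζ => (Φ ζ - b * ζ / R).re ^ 2) 0 R ≤
      32 * (ε ^ 2 * (1 - ρ) * r ^ 2 / 512)) {w : ℂ} (hw : ‖w‖ ≤ ρ) :
    |(Φ w).re - (b * w).re| ≤ ε := by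
  have hR : 0 < R := hr.trans hrR
  have hρ0 : 0 ≤ ρ := (norm_nonneg w).trans hw
  have hΨ : DifferentiableOn ℂ (fun ζ => Φ ζ - b * ζ / R) (ball 0 1) :=
    hΦ.sub (by fun_prop)
  have h1 := abs_re_le_of_circleAverage_sq hΨ hR1 (w := w) (by linarith) (half_pos hε)
  set E := Real.circleAverage (fun ζ => (Φ ζ - b * ζ / R).re ^ 2) 0 R with hE
  have hE0 : 0 ≤ E := Real.circleAverage_nonneg_of_nonneg fun x _ => sq_nonneg _
  have hE1 : E ≤ ε ^ 2 * (1 - ρ) / 16 := by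
    have h2 : r ^ 2 ≤ (r / R) ^ 2 := by
      gcongr
      exact (le_div_iff₀ hR).2 (by nlinarith)
    have h3 : r ^ 2 * E ≤ r ^ 2 * (ε ^ 2 * (1 - ρ) / 16) := by nlinarith
    exact le_of_mul_le_mul_left h3 (by positivity)
  have hC : (R + ‖w‖) / (R - ‖w‖) ≤ 4 / (1 - ρ) := by
    rw [div_le_div_iff₀ (by linarith) (by linarith)]
    nlinarith
  have h4 : (R + ‖w‖) / (R - ‖w‖) / (2 * (ε / 2)) * E ≤ ε / 4 := by
    have hρ2 : 0 < 1 - ρ := by linarith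
    calc (R + ‖w‖) / (R - ‖w‖) / (2 * (ε / 2)) * E
        ≤ 4 / (1 - ρ) / (2 * (ε / 2)) * (ε ^ 2 * (1 - ρ) / 16) := by gcongr
      _ = ε / 4 := by
        field_simp
        norm_num
  have h5 : |(b * w).re / R - (b * w).re| ≤ ε / 2 := by
    have h6 : |(b * w).re| ≤ 1 := by
      refine (abs_re_le_norm _).trans ?_
      rw [norm_mul, hb, one_mul]
      linarith
    have h7 : 0 ≤ 1 / R - 1 := by
      rw [sub_nonneg, le_div_iff₀ hR]
      linarith
    rw [show (b * w).re / R - (b * w).re = (1 / R - 1) * (b * w).re by ring, abs_mul,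
      abs_of_nonneg h7]
    nlinarith [abs_nonneg (b * w).re]
  rw [sub_re, div_ofReal_re] at h1
  have h8 : (Φ w).re - (b * w).re =
      ((Φ w).re - (b * w).re / R) + ((b * w).re / R - (b * w).re) := by ring
  rw [h8]
  exact (abs_add_le _ _).trans (by linarith)

theorem exists_unit_approx {h g : ℂ → ℂ}
    (hh : DifferentiableOn ℂ h (ball (0 : ℂ) 1)) (hg : DifferentiableOn ℂ g (ball (0 : ℂ) 1))
    (hbd : ∀ z ∈ ball (0 : ℂ) 1, ‖h z + (starRingEnd ℂ) (g z)‖ ≤ 1) {r : ℝ} (hr : 0 < r)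
    (hr1 : r < 1)
    (hvol : ENNReal.ofReal (Real.pi * r ^ 2) ≤
      volume ((fun z => h z + (starRingEnd ℂ) (g z)) '' closedBall (0 : ℂ) r))
    {ρ ε : ℝ} (hρ1 : ρ < 1) (hε : 0 < ε) :
    ∃ a b c : ℂ, ‖a‖ = 1 ∧ ‖b‖ = 1 ∧ ‖c‖ = 1 ∧ ∀ w : ℂ, ‖w‖ ≤ ρ →
      |((starRingEnd ℂ) a * (h w + (starRingEnd ℂ) (g w))).re - (b * w).re| ≤ ε ∧
      |((starRingEnd ℂ) a * (h w + (starRingEnd ℂ) (g w))).im - (c * w).re| ≤ ε := by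
  set η := ε ^ 2 * (1 - ρ) * r ^ 2 / 512 with hη
  have hη0 : 0 < η := by
    have : 0 < 1 - ρ := by linarith
    positivity
  have hcont : ContinuousAt (fun R : ℝ => 2 * (r / R) * (r / R - r) / (1 - (r / R) ^ 2)) 1 := by
    have : (1 : ℝ) - (r / 1) ^ 2 ≠ 0 := by
      rw [div_one]
      nlinarith
    fun_prop (disch := first | assumption | norm_num)
  have e1 := Filter.Tendsto.eventually_lt_const (u := η) (by simpa using hη0) hcont
  have e2 : ∀ᶠ R : ℝ in nhds 1, 1 / R - 1 < ε / 2 := by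
    have hc : ContinuousAt (fun R : ℝ => 1 / R - 1) 1 := by
      fun_prop (disch := norm_num)
    exact hc.eventually (gt_mem_nhds (by simpa using hε))
  have e3 : ∀ᶠ R : ℝ in nhds 1, (1 + ρ) / 2 < R := lt_mem_nhds (by linarith)
  have e4 : ∀ᶠ R : ℝ in nhds 1, r < R := lt_mem_nhds hr1
  have e5 := ((e1.and (e2.and (e3.and e4))).filter_mono
    (nhdsWithin_le_nhds (s := Set.Iio 1))).and self_mem_nhdsWithin
  obtain ⟨R, ⟨hD, hRε, hρR, hrR⟩, hR1⟩ := e5.exists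
  obtain ⟨α, z, z', hz, hz', hle, hle'⟩ :=
    exists_orthogonal_log_defect_le hh hg hbd hr hrR hR1 hvol hD
  have hunit : ∀ {z : ℂ}, ‖z‖ = r → ‖(starRingEnd ℂ) z / r‖ = 1 := by
    intro z hz
    rw [norm_div, norm_conj, hz, norm_real, Real.norm_of_nonneg hr.le, div_self hr.ne']
  have hconj : (starRingEnd ℂ) (exp (α * I)) = exp (-(α * I)) := by
    rw [← exp_conj, map_mul, conj_ofReal, conj_I, mul_neg]
  refine ⟨exp (α * I), _, _, norm_exp_ofReal_mul_I α, hunit hz, hunit hz', fun w hw => ⟨?_, ?_⟩⟩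
  · rw [hconj, ← re_rotatedHolomorphic]
    exact abs_re_sub_le_of_circleAverage_sq_le (differentiableOn_rotatedHolomorphic hh hg _)
      hr hrR hR1 hρ1 hε hρR.le hRε.le (hunit hz) hle hw
  · have him : (exp (-(α * I)) * (h w + (starRingEnd ℂ) (g w))).im =
        (exp (-(((α + Real.pi / 2 : ℝ) : ℂ) * I)) * (h w + (starRingEnd ℂ) (g w))).re := by
      have h1 : exp (-(((α + Real.pi / 2 : ℝ) : ℂ) * I)) = exp (-(α * I)) * -I := by
        rw [← exp_neg_pi_div_two_mul_I, ← exp_add]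
        push_cast
        ring_nf
      rw [h1, mul_assoc, mul_left_comm]
      simp
    rw [hconj, him, ← re_rotatedHolomorphic]
    exact abs_re_sub_le_of_circleAverage_sq_le (differentiableOn_rotatedHolomorphic hh hg _)
      hr hrR hR1 hρ1 hε hρR.le hRε.le (hunit hz') hle' hw

theorem exists_unit_eq {f : ℂ → ℂ}
    (hf : ∀ ρ ε : ℝ, ρ < 1 → 0 < ε → ∃ a b c : ℂ, ‖a‖ = 1 ∧ ‖b‖ = 1 ∧ ‖c‖ = 1 ∧
      ∀ w : ℂ, ‖w‖ ≤ ρ → |((starRingEnd ℂ) a * f w).re - (b * w).re| ≤ ε ∧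
        |((starRingEnd ℂ) a * f w).im - (c * w).re| ≤ ε) :
    ∃ a b c : ℂ, ‖a‖ = 1 ∧ ‖b‖ = 1 ∧ ‖c‖ = 1 ∧ ∀ w ∈ ball (0 : ℂ) 1,
      ((starRingEnd ℂ) a * f w).re = (b * w).re ∧ ((starRingEnd ℂ) a * f w).im = (c * w).re := by
  set T : ℕ → Set (ℂ × ℂ × ℂ) := fun n => {p | ∀ w : ℂ, ‖w‖ ≤ 1 - 1 / (n + 1 : ℝ) →
      |((starRingEnd ℂ) p.1 * f w).re - (p.2.1 * w).re| ≤ 1 / (n + 1 : ℝ) ∧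
        |((starRingEnd ℂ) p.1 * f w).im - (p.2.2 * w).re| ≤ 1 / (n + 1 : ℝ)} with hT
  set K : Set (ℂ × ℂ × ℂ) := sphere 0 1 ×ˢ (sphere 0 1 ×ˢ sphere 0 1) with hK
  have hKc : IsCompact K := (isCompact_sphere 0 1).prod
    ((isCompact_sphere 0 1).prod (isCompact_sphere 0 1))
  have hTc : ∀ n, IsClosed (T n) := by
    intro n
    simp only [hT, Set.ofPred_forall, Set.ofPred_and]
    refine isClosed_iInter fun w => isClosed_iInter fun _ => ?_
    exact (isClosed_le (by fun_prop) continuous_const).inter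
      (isClosed_le (by fun_prop) continuous_const)
  obtain ⟨⟨a, b, c⟩, hp⟩ := IsCompact.nonempty_iInter_of_sequence_nonempty_isCompact_isClosed
    (fun n => K ∩ T n) (by
      rintro n p ⟨hpK, hpT⟩
      refine ⟨hpK, fun w hw => ?_⟩
      have h1 : (1 : ℝ) / ((n + 1 : ℕ) + 1 : ℝ) ≤ 1 / (n + 1 : ℝ) := by
        push_cast
        gcongr
        linarith
      obtain ⟨h2, h3⟩ := hpT w (by linarith)
      exact ⟨h2.trans h1, h3.trans h1⟩)
    (by
      intro n
      have hn : (0 : ℝ) < 1 / (n + 1 : ℝ) := by positivity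
      obtain ⟨a, b, c, ha, hb, hc, h⟩ := hf (1 - 1 / (n + 1 : ℝ)) (1 / (n + 1 : ℝ)) (by linarith) hn
      exact ⟨(a, b, c), ⟨by simpa using ha, by simpa using hb, by simpa using hc⟩, h⟩)
    (hKc.inter_right (hTc 0)) (fun n => hKc.isClosed.inter (hTc n))
  rw [Set.mem_iInter] at hp
  obtain ⟨ha, hb, hc⟩ := (hp 0).1
  refine ⟨a, b, c, by simpa using ha, by simpa using hb, by simpa using hc, fun w hw => ?_⟩
  have hlim := tendsto_one_div_add_atTop_nhds_zero_nat (𝕜 := ℝ)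
  have hev : ∀ᶠ n : ℕ in Filter.atTop, ‖w‖ ≤ 1 - 1 / (n + 1 : ℝ) := by
    have hw' : 0 < 1 - ‖w‖ := by simpa using hw
    filter_upwards [hlim.eventually_le_const hw'] with n hn
    linarith
  constructor <;> rw [← sub_eq_zero, ← abs_eq_zero] <;> refine le_antisymm ?_ (abs_nonneg _)
  · exact ge_of_tendsto hlim (hev.mono fun n hn => ((hp n).2 w hn).1)
  · exact ge_of_tendsto hlim (hev.mono fun n hn => ((hp n).2 w hn).2)

theorem eq_or_eq_of_bounded_linear {f : ℂ → ℂ} {a b c : ℂ} (ha : ‖a‖ = 1) (hb : ‖b‖ = 1)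
    (hc : ‖c‖ = 1) (hself : Set.MapsTo f (ball (0 : ℂ) 1) (ball (0 : ℂ) 1))
    (hf : ∀ w ∈ ball (0 : ℂ) 1,
      ((starRingEnd ℂ) a * f w).re = (b * w).re ∧ ((starRingEnd ℂ) a * f w).im = (c * w).re) :
    (∀ w ∈ ball (0 : ℂ) 1, f w = a * b * w) ∨
      (∀ w ∈ ball (0 : ℂ) 1, f w = a * (starRingEnd ℂ) (b * w)) := by
  have hbb : b * (starRingEnd ℂ) b = 1 := by rw [mul_conj, normSq_eq_norm_sq, hb]; simp
  have haa : a * (starRingEnd ℂ) a = 1 := by rw [mul_conj, normSq_eq_norm_sq, ha]; simp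
  have hre : (c * (starRingEnd ℂ) b).re = 0 := by
    by_contra hκ
    set κ := (c * (starRingEnd ℂ) b).re with hκdef
    have hκ2 : 0 < κ ^ 2 := by positivity
    obtain ⟨s, hs0, hs⟩ : ∃ s : ℝ, 0 ≤ s ∧ s ^ 2 = 1 / (1 + κ ^ 2) :=
      ⟨√(1 / (1 + κ ^ 2)), Real.sqrt_nonneg _, Real.sq_sqrt (by positivity)⟩
    have hs' : s ^ 2 * (1 + κ ^ 2) = 1 := by rw [hs]; field_simp
    have hs1 : s < 1 := by
      by_contra! h1
      have := one_le_pow₀ (n := 2) h1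
      nlinarith
    have hw : (s : ℂ) * (starRingEnd ℂ) b ∈ ball (0 : ℂ) 1 := by
      simpa [hb, abs_of_nonneg hs0] using hs1
    obtain ⟨h1, h2⟩ := hf _ hw
    have h3 := hself hw
    rw [mul_left_comm, re_ofReal_mul] at h1 h2
    rw [hbb, one_re, mul_one] at h1
    have h4 : ‖(starRingEnd ℂ) a * f ((s : ℂ) * (starRingEnd ℂ) b)‖ ^ 2 = 1 := by
      rw [← normSq_eq_norm_sq, normSq_apply, h1, h2, ← hs']
      ring
    rw [norm_mul, norm_conj, ha, one_mul] at h4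
    have h5 : ‖f ((s : ℂ) * (starRingEnd ℂ) b)‖ < 1 := by simpa using h3
    nlinarith [norm_nonneg (f ((s : ℂ) * (starRingEnd ℂ) b))]
  obtain ⟨μ, hμ⟩ : ∃ μ : ℝ, c = μ * I * b := by
    refine ⟨(c * (starRingEnd ℂ) b).im, ?_⟩
    have h1 : c * (starRingEnd ℂ) b = ((c * (starRingEnd ℂ) b).im : ℂ) * I := by
      conv_lhs => rw [← re_add_im (c * (starRingEnd ℂ) b), hre]
      simp
    rw [← h1, mul_assoc, mul_comm _ b, hbb, mul_one]
  have hμ1 : |μ| = 1 := by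
    rw [hμ] at hc
    simpa [hb] using hc
  have hfw : ∀ w, f w = a * ((starRingEnd ℂ) a * f w) := fun w => by
    rw [← mul_assoc, haa, one_mul]
  have him : ∀ w, (c * w).re = -μ * (b * w).im := fun w => by
    rw [hμ, mul_assoc, mul_assoc, re_ofReal_mul, I_mul_re]
    ring
  rcases (abs_eq zero_le_one).1 hμ1 with rfl | rfl
  · right
    intro w hw
    rw [hfw]
    congr 1
    obtain ⟨h1, h2⟩ := hf w hw
    apply Complex.ext
    · rw [h1, conj_re]
    · rw [h2, him, conj_im]
      ring
  · left
    intro w hw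
    rw [hfw, mul_assoc]
    congr 1
    obtain ⟨h1, h2⟩ := hf w hw
    apply Complex.ext
    · rw [h1]
    · rw [h2, him]
      ring

theorem deriv_eq_zero_of_eqOn_conj {F G : ℂ → ℂ} {s : Set ℂ} (hs : IsOpen s)
    (hF : DifferentiableOn ℂ F s) (hG : DifferentiableOn ℂ G s)
    (heq : ∀ z ∈ s, F z = (starRingEnd ℂ) (G z)) {z : ℂ} (hz : z ∈ s) :
    deriv F z = 0 ∧ deriv G z = 0 := by
  have hmem := hs.mem_nhds hz
  have h1 := (hF.differentiableAt hmem).hasDerivAt.hasFDerivAt.restrictScalars ℝ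
  have h2 := (hG.differentiableAt hmem).hasDerivAt.hasFDerivAt.restrictScalars ℝ
  have h3 := (conjCLE.toContinuousLinearMap.hasFDerivAt (x := G z)).comp z h2
  have h4 := h1.unique (h3.congr_of_eventuallyEq
    (Filter.eventually_of_mem hmem fun w hw => heq w hw))
  have h5 := DFunLike.congr_fun h4 1
  have h6 := DFunLike.congr_fun h4 I
  simp at h5 h6
  have h7 : deriv F z = 0 := by
    have h8 : I * deriv F z = -(I * deriv F z) := by
      rwa [← h5] at h6
    have h9 : I * deriv F z = 0 := self_eq_neg.1 h8
    simpa using h9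
  refine ⟨h7, ?_⟩
  rw [h7] at h5
  simpa using h5.symm

/-- Rigidity: if a sense-preserving univalent harmonic self-mapping
of the unit disk satisfies `m(f(𝔻_r)) = π r²` for some `0 < r < 1`, then `f` is a
conformal automorphism of the disk: `g` is constant and
`f z = e^{iθ}(z - a)/(1 - conj a · z)`. -/
theorem rigidity_area_preservation
    (h g : ℂ → ℂ)
    (hh : DifferentiableOn ℂ h (ball (0 : ℂ) 1))
    (hg : DifferentiableOn ℂ g (ball (0 : ℂ) 1))
    (f : ℂ → ℂ) (hf : f = fun z => h z + (starRingEnd ℂ) (g z))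
    (hinj : Set.InjOn f (ball (0 : ℂ) 1))
    (hself : Set.MapsTo f (ball (0 : ℂ) 1) (ball (0 : ℂ) 1))
    (hsp : ∀ z ∈ ball (0 : ℂ) 1, ‖deriv g z‖ < ‖deriv h z‖)
    (r : ℝ) (hr0 : 0 < r) (hr1 : r < 1)
    (heq : volume (f '' ball (0 : ℂ) r) = ENNReal.ofReal (Real.pi * r ^ 2)) :
    (∀ z ∈ ball (0 : ℂ) 1, ∀ w ∈ ball (0 : ℂ) 1, g z = g w) ∧
      ∃ θ : ℝ, ∃ a : ℂ, ‖a‖ < 1 ∧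
        ∀ z ∈ ball (0 : ℂ) 1,
          f z = Complex.exp (θ * Complex.I) * (z - a) / (1 - (starRingEnd ℂ) a * z) := by
  have hbd : ∀ z ∈ ball (0 : ℂ) 1, ‖h z + (starRingEnd ℂ) (g z)‖ ≤ 1 := by
    intro z hz
    have h1 := hself hz
    rw [hf, mem_ball_zero_iff] at h1
    exact h1.le
  have hvol : ENNReal.ofReal (Real.pi * r ^ 2) ≤
      volume ((fun z => h z + (starRingEnd ℂ) (g z)) '' closedBall (0 : ℂ) r) := by
    rw [← heq, hf]
    exact measure_mono (Set.image_mono ball_subset_closedBall)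
  obtain ⟨a, b, c, ha, hb, hc, habc⟩ := exists_unit_eq (f := f) fun ρ ε hρ hε => by
    rw [hf]
    exact exists_unit_approx hh hg hbd hr0 hr1 hvol hρ hε
  rcases eq_or_eq_of_bounded_linear ha hb hc hself habc with hlin | hlin
  · refine ⟨fun z hz w hw => ?_, arg (a * b), 0, by simp, fun z hz => ?_⟩
    · refine isOpen_ball.is_const_of_deriv_eq_zero (convex_ball (0 : ℂ) 1).isPreconnected hg
        (fun x hx => ?_) hz hw
      refine (deriv_eq_zero_of_eqOn_conj isOpen_ball
        (F := fun z => a * b * z - h z) (by fun_prop) hg (fun w hw => ?_) hx).2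
      rw [← hlin w hw, hf]
      ring
    · have h1 := norm_mul_exp_arg_mul_I (a * b)
      rw [norm_mul, ha, hb, one_mul, ofReal_one, one_mul] at h1
      rw [hlin z hz, h1]
      simp
  · have h0 : (0 : ℂ) ∈ ball (0 : ℂ) 1 := by simp
    have h1 := (deriv_eq_zero_of_eqOn_conj isOpen_ball hh
      (G := fun z => (starRingEnd ℂ) a * (b * z) - g z) (by fun_prop) (fun w hw => ?_) h0).1
    · have h2 := hsp 0 h0
      rw [h1, norm_zero] at h2
      exact absurd h2 (norm_nonneg _).not_gt
    · rw [map_sub, map_mul, conj_conj, ← hlin w hw, hf]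
      ring
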